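/- Let M ≥ 1, t ∈ 𝒯_M, L ≥ 1, and let j, k be odd positive integers with j + k = 2L. For each n ∈ ℕ let r^{(n)} ∈ ℝ^j and s^{(n)} ∈ ℝ^k be such that the concatenated list (r^{(n)}_1, …, r^{(n)}_j, t_1, …, t_{2M}, s^{(n)}_1, …, s^{(n)}_k) is strictly increasing (an element of 𝒯_{M+L}), and suppose r^{(n)}_j → −∞ and s^{(n)}_1 → +∞ as n → ∞. Then liminf_{n→∞} sSup σ(B^{(M+L)}_{⟨r^{(n)}, t, s^{(n)}⟩}) ≥ −1 − sInf σ(B^{(M)}_t) and limsup_{n→∞} sInf σ(B^{(M+L)}_{⟨r^{(n)}, t, s^{(n)}⟩}) ≤ −1 − sSup σ(B^{(M)}_t). -/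

import Mathlib

open MeasureTheory Filter

noncomputable section

namespace QB

/-- Lebesgue measure on the positive half-line. -/
abbrev μp : Measure ℝ := volume.restrict (Set.Ioi (0:ℝ))

/-- The Hilbert space `L²((0,∞))`. -/
abbrev Hp : Type := Lp ℂ 2 μp

/-- The Hilbert space `L²(ℝ)`. -/
abbrev HL : Type := Lp ℂ 2 (volume : Measure ℝ)

/-- The defining properties of the operators: `S t` is multiplication by `e^{-i k² t}`,
`R` is the isometry "extend by zero and apply the inverse Fourier–Plancherel transform"
(characterised by its isometry property together with the integral formula on
integrable elements of `L²((0,∞))`, which determine it uniquely by continuity and density),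
and `Pm` is the orthogonal projection onto functions supported in `(-∞,0)`. -/
structure Setup (S : ℝ → Hp →L[ℂ] Hp) (R : Hp →L[ℂ] HL) (Pm : HL →L[ℂ] HL) : Prop where
  hS : ∀ (t : ℝ) (φ : Hp),
    (S t φ : ℝ → ℂ) =ᵐ[μp] fun k => Complex.exp (-Complex.I * (k:ℂ)^2 * (t:ℂ)) * φ k
  hR_isometry : ∀ φ : Hp, ‖R φ‖ = ‖φ‖
  hR : ∀ φ : Hp, Integrable (φ : ℝ → ℂ) μp →
    (R φ : ℝ → ℂ) =ᵐ[volume]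
      fun x => (((2 * Real.pi) ^ (-(1/2) : ℝ) : ℝ) : ℂ) *
        ∫ k in Set.Ioi (0:ℝ), Complex.exp (Complex.I * (x:ℂ) * (k:ℂ)) * φ k
  hPm : ∀ ψ : HL, (Pm ψ : ℝ → ℂ) =ᵐ[volume] Set.indicator (Set.Iio (0:ℝ)) (fun x => ψ x)

/-- The single backflow operator `B_{⟨t₁,t₂⟩} = S_{t₂}* R* Π⁻ R S_{t₂} − S_{t₁}* R* Π⁻ R S_{t₁}`. -/
def B1 (S : ℝ → Hp →L[ℂ] Hp) (R : Hp →L[ℂ] HL) (Pm : HL →L[ℂ] HL) (t₁ t₂ : ℝ) :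
    Hp →L[ℂ] Hp :=
  (ContinuousLinearMap.adjoint (S t₂)).comp ((ContinuousLinearMap.adjoint R).comp
    (Pm.comp (R.comp (S t₂))))
  - (ContinuousLinearMap.adjoint (S t₁)).comp ((ContinuousLinearMap.adjoint R).comp
    (Pm.comp (R.comp (S t₁))))

/-- The `M`-fold backflow operator `B^{(M)}_t = Σ_{j=1}^M B_{⟨t_{2j-1}, t_{2j}⟩}`
(zero-based indexing of the tuple `t`). -/
def BM (S : ℝ → Hp →L[ℂ] Hp) (R : Hp →L[ℂ] HL) (Pm : HL →L[ℂ] HL) (M : ℕ)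
    (t : Fin (2*M) → ℝ) : Hp →L[ℂ] Hp :=
  ∑ j : Fin M, B1 S R Pm (t ⟨2*j.1, by have := j.isLt; omega⟩)
    (t ⟨2*j.1+1, by have := j.isLt; omega⟩)

/-- `𝒯_M`: the set of strictly increasing `2M`-tuples of reals. -/
def TM (M : ℕ) : Set (Fin (2*M) → ℝ) := {t | StrictMono t}

/-- The concatenation `(r₁,…,r_j, t₁,…,t_{2M}, s₁,…,s_k)`, viewed as a `2(M+L)`-tuple
(using `j + k = 2L`). -/
def concat3 {j M k L : ℕ} (hjk : j + k = 2*L) (r : Fin j → ℝ) (t : Fin (2*M) → ℝ)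
    (s : Fin k → ℝ) : Fin (2*(M+L)) → ℝ := fun i =>
  if h1 : (i:ℕ) < j then r ⟨i, h1⟩
  else if h2 : (i:ℕ) < j + 2*M then t ⟨(i:ℕ) - j, by omega⟩
  else s ⟨(i:ℕ) - (j + 2*M), by have := i.isLt; omega⟩

lemma limsup_neg_real {ι : Type*} (f : Filter ι) (u : ι → ℝ) :
    limsup (fun n => -u n) f = -liminf u f := by
  rw [limsup_eq, liminf_eq, Real.sInf_def]
  congr 2
  ext a
  simp

section Spectral

variable {H : Type*} [NormedAddCommGroup H] [InnerProductSpace ℂ H]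

lemma reApplyInnerSelf_algebraMap_sub (A : H →L[ℂ] H) (c : ℝ) (x : H) :
    (algebraMap ℝ (H →L[ℂ] H) c - A).reApplyInnerSelf x = c * ‖x‖ ^ 2 - A.reApplyInnerSelf x := by
  simp [ContinuousLinearMap.reApplyInnerSelf_apply, Algebra.algebraMap_eq_smul_one, inner_sub_left,
    inner_smul_left_eq_star_smul, inner_self_eq_norm_sq_to_K, ← Complex.ofReal_pow]

lemma sInf_spectrum_eq_neg (A : H →L[ℂ] H) :
    sInf (spectrum ℝ A) = -sSup (spectrum ℝ (-A)) := by
  rw [← spectrum.neg_eq, Real.sInf_def]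

variable [CompleteSpace H]

lemma le_algebraMap_iff_reApplyInnerSelf {A : H →L[ℂ] H} (hA : IsSelfAdjoint A) (c : ℝ) :
    A ≤ algebraMap ℝ (H →L[ℂ] H) c ↔ ∀ x, A.reApplyInnerSelf x ≤ c * ‖x‖ ^ 2 := by
  have hsa : IsSelfAdjoint (algebraMap ℝ (H →L[ℂ] H) c - A) :=
    ((IsSelfAdjoint.all c).algebraMap _).sub hA
  rw [ContinuousLinearMap.le_def, ContinuousLinearMap.isPositive_def']
  simp only [hsa, true_and, reApplyInnerSelf_algebraMap_sub, sub_nonneg]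

lemma reApplyInnerSelf_le_sSup_spectrum {A : H →L[ℂ] H} (hA : IsSelfAdjoint A) (x : H) :
    A.reApplyInnerSelf x ≤ sSup (spectrum ℝ A) * ‖x‖ ^ 2 := by
  refine (le_algebraMap_iff_reApplyInnerSelf hA _).1 (le_algebraMap_of_spectrum_le ?_) x
  exact fun y hy => le_csSup (spectrum.isBounded A).bddAbove hy

lemma sSup_spectrum_le [Nontrivial H] {A : H →L[ℂ] H} (hA : IsSelfAdjoint A) {c : ℝ}
    (h : ∀ x, A.reApplyInnerSelf x ≤ c * ‖x‖ ^ 2) : sSup (spectrum ℝ A) ≤ c :=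
  csSup_le (ContinuousFunctionalCalculus.spectrum_nonempty A hA) <|
    (le_algebraMap_iff_spectrum_le hA).1 ((le_algebraMap_iff_reApplyInnerSelf hA c).2 h)

lemma sSup_spectrum_le_norm [Nontrivial H] (A : H →L[ℂ] H) (hA : IsSelfAdjoint A) :
    sSup (spectrum ℝ A) ≤ ‖A‖ :=
  csSup_le (ContinuousFunctionalCalculus.spectrum_nonempty A hA) fun y hy =>
    (le_abs_self y).trans (by simpa using spectrum.norm_le_norm_of_mem hy)

lemma sSup_spectrum_le_liminf [Nontrivial H] {A : ℕ → H →L[ℂ] H} {B : H →L[ℂ] H}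
    (hA : ∀ n, IsSelfAdjoint (A n)) (hB : IsSelfAdjoint B) {C : ℝ} (hC : ∀ n, ‖A n‖ ≤ C)
    (h : ∀ x, Tendsto (fun n => A n x) atTop (nhds (B x))) :
    sSup (spectrum ℝ B) ≤ liminf (fun n => sSup (spectrum ℝ (A n))) atTop := by
  refine le_of_forall_lt fun c hc => ?_
  obtain ⟨c', hcc', hc'⟩ := exists_between hc
  refine hcc'.trans_le ?_
  obtain ⟨x, hx⟩ : ∃ x, c' * ‖x‖ ^ 2 < B.reApplyInnerSelf x := by
    by_contra! hcon
    exact hc'.not_ge (sSup_spectrum_le hB hcon)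
  have hlim : Tendsto (fun n => (A n).reApplyInnerSelf x) atTop (nhds (B.reApplyInnerSelf x)) := by
    simp only [ContinuousLinearMap.reApplyInnerSelf_apply]
    exact (RCLike.continuous_re.tendsto _).comp ((h x).inner tendsto_const_nhds)
  have hx0 : 0 < ‖x‖ ^ 2 := by
    rcases eq_or_ne x 0 with rfl | hx0
    · simp [ContinuousLinearMap.reApplyInnerSelf_apply] at hx
    · positivity
  refine le_liminf_of_le ?_ ?_
  · exact IsBoundedUnder.isCoboundedUnder_ge
      ⟨C, eventually_map.2 (.of_forall fun n => (sSup_spectrum_le_norm _ (hA n)).trans (hC n))⟩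
  · filter_upwards [hlim.eventually_const_lt hx] with n hn
    exact le_of_mul_le_mul_right (hn.le.trans (reApplyInnerSelf_le_sSup_spectrum (hA n) x)) hx0

lemma sSup_spectrum_neg_one_sub [Nontrivial H] {A : H →L[ℂ] H} (hA : IsSelfAdjoint A) :
    sSup (spectrum ℝ (-1 - A)) = -1 - sInf (spectrum ℝ A) := by
  have h1 : spectrum ℝ (-1 - A) = (fun x => -1 - x) '' spectrum ℝ A := by
    have := spectrum.singleton_sub_eq A (-1 : ℝ)
    simp only [map_neg, map_one] at this
    rw [← this, Set.singleton_sub]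
  have hne := ContinuousFunctionalCalculus.spectrum_nonempty (R := ℝ) A hA
  have hb := (spectrum.isBounded (𝕜 := ℝ) A).bddBelow
  rw [h1]
  exact (Antitone.map_csInf_of_continuousAt (f := fun x : ℝ => -1 - x) (by fun_prop)
    (fun a b hab => sub_le_sub_left hab _) hne hb).symm

lemma liminf_limsup_spectrum_of_tendsto_neg_one_sub [Nontrivial H] {A : ℕ → H →L[ℂ] H}
    {B : H →L[ℂ] H} (hA : ∀ n, IsSelfAdjoint (A n)) (hB : IsSelfAdjoint B) {C : ℝ}
    (hC : ∀ n, ‖A n‖ ≤ C) (h : ∀ x, Tendsto (fun n => A n x) atTop (nhds (-x - B x))) :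
    -1 - sInf (spectrum ℝ B) ≤ liminf (fun n => sSup (spectrum ℝ (A n))) atTop ∧
    limsup (fun n => sInf (spectrum ℝ (A n))) atTop ≤ -1 - sSup (spectrum ℝ B) := by
  have hL : IsSelfAdjoint (-1 - B) := (IsSelfAdjoint.one _).neg.sub hB
  constructor
  · rw [← sSup_spectrum_neg_one_sub hB]
    exact sSup_spectrum_le_liminf hA hL hC (by simpa using h)
  · have h' := sSup_spectrum_le_liminf (fun n => (hA n).neg) hL.neg (C := C) (by simpa using hC)
      (fun x => by simpa [add_comm] using (h x).neg)
    have h1 : -1 - sSup (spectrum ℝ B) = sInf (spectrum ℝ (-1 - B)) := by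
      have := sSup_spectrum_neg_one_sub hL
      rw [sub_sub_cancel] at this
      linarith
    simp_rw [sInf_spectrum_eq_neg (A _), limsup_neg_real]
    rw [h1, sInf_spectrum_eq_neg]
    exact neg_le_neg h'

end Spectral

lemma abs_sub_two_mul_eq {x k t : ℝ} (hk : 0 < k) (hxt : x * t ≤ 0) :
    |x - 2 * k * t| = |x| + 2 * k * |t| := by
  have h := (abs_add_eq_add_abs_iff x (-(2 * k * t))).2 ?_
  · rwa [← sub_eq_add_neg, abs_neg, abs_mul, abs_of_pos (by positivity : 0 < 2 * k)] at h
  · rcases mul_nonpos_iff.1 hxt with ⟨h1, h2⟩ | ⟨h1, h2⟩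
    · exact .inl ⟨h1, by nlinarith⟩
    · exact .inr ⟨h1, by nlinarith [mul_nonneg hk.le h2]⟩

/-- Nonstationary phase: one integration by parts for the phase `x k - t k²` when `x` and `t` have
opposite signs. -/
lemma norm_integral_oscillatory_le {g : ℝ → ℝ} (hg : ContDiff ℝ 1 g) {a b C₀ C₁ x t : ℝ}
    (ha : 0 < a) (hab : a ≤ b) (hga : g a = 0) (hgb : g b = 0) (hC₀ : ∀ k, |g k| ≤ C₀)
    (hC₁ : ∀ k, |deriv g k| ≤ C₁) (ht : t ≠ 0) (hxt : x * t ≤ 0) :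
    ‖∫ k in a..b, (g k : ℂ) * Complex.exp (Complex.I * (x * k - k ^ 2 * t))‖ ≤
      (C₁ + C₀ / a) * (b - a) / (|x| + 2 * a * |t|) := by
  set d := |x| + 2 * a * |t| with hd
  have ht' : 0 < |t| := abs_pos.2 ht
  have hd0 : 0 < d := by positivity
  have hD : ∀ k ∈ Set.Icc a b, d ≤ |x - 2 * k * t| := fun k hk => by
    rw [abs_sub_two_mul_eq (ha.trans_le hk.1) hxt, hd]
    gcongr
    exact hk.1
  have hD0 : ∀ k ∈ Set.Icc a b, x - 2 * k * t ≠ 0 := fun k hk =>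
    abs_pos.1 (hd0.trans_le (hD k hk))
  set u' : ℝ → ℝ := fun k =>
    (deriv g k * (x - 2 * k * t) - g k * (-(2 * t))) / (x - 2 * k * t) ^ 2 with hu'
  have hu : ∀ k ∈ Set.Icc a b, HasDerivAt (fun k => g k / (x - 2 * k * t)) (u' k) k := fun k hk => by
    have h1 : HasDerivAt (fun k : ℝ => x - 2 * k * t) (-(2 * t)) k := by
      simpa using (((hasDerivAt_id k).const_mul 2).mul_const t).const_sub x
    exact (hg.differentiable (by norm_num) k).hasDerivAt.div h1 (hD0 k hk)
  have hv : ∀ k : ℝ, HasDerivAt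
      (fun k : ℝ => -Complex.I * Complex.exp (Complex.I * (x * k - k ^ 2 * t)))
      ((x - 2 * k * t : ℝ) * Complex.exp (Complex.I * (x * k - k ^ 2 * t))) k := fun k => by
    have h1 : HasDerivAt (fun z : ℂ => Complex.I * (x * z - z ^ 2 * t))
        (Complex.I * (x - 2 * k * t)) (k : ℂ) := by
      simpa using ((((hasDerivAt_id (k : ℂ)).const_mul (x : ℂ)).sub
        (((hasDerivAt_id (k : ℂ)).pow 2).mul_const (t : ℂ))).const_mul Complex.I)
    have h2 := (h1.cexp.const_mul (-Complex.I)).comp_ofReal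
    refine h2.congr_deriv ?_
    push_cast
    linear_combination (-(x - 2 * k * t) * Complex.exp (Complex.I * (x * k - k ^ 2 * t))) *
      Complex.I_mul_I
  have hcu' : ContinuousOn u' (Set.Icc a b) := by
    have := hg.continuous_deriv le_rfl
    have := hg.continuous
    refine ContinuousOn.div (by fun_prop) (by fun_prop) fun k hk => pow_ne_zero 2 (hD0 k hk)
  have huIcc : Set.uIcc a b = Set.Icc a b := Set.uIcc_of_le hab
  have hparts := intervalIntegral.integral_mul_deriv_eq_deriv_mul (a := a) (b := b)
    (u := fun k => ((g k / (x - 2 * k * t) : ℝ) : ℂ)) (u' := fun k => (u' k : ℂ))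
    (fun k hk => (hu k (huIcc ▸ hk)).ofReal_comp) (fun k _ => hv k)
    ((Complex.continuous_ofReal.comp_continuousOn (huIcc ▸ hcu')).intervalIntegrable)
    (Continuous.intervalIntegrable (by fun_prop) _ _)
  have hEq : ∫ k in a..b, (g k : ℂ) * Complex.exp (Complex.I * (x * k - k ^ 2 * t)) =
      ∫ k in a..b, ((g k / (x - 2 * k * t) : ℝ) : ℂ) *
        ((x - 2 * k * t : ℝ) * Complex.exp (Complex.I * (x * k - k ^ 2 * t))) := by
    refine intervalIntegral.integral_congr fun k hk => ?_
    simp only [← mul_assoc, ← Complex.ofReal_mul, div_mul_cancel₀ _ (hD0 k (huIcc ▸ hk))]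
  rw [hEq, hparts]
  simp only [hga, hgb, zero_div, Complex.ofReal_zero, zero_mul, sub_zero, zero_sub, norm_neg]
  refine (intervalIntegral.norm_integral_le_of_norm_le_const
    (C := (C₁ + C₀ / a) / d) fun k hk => ?_).trans_eq ?_
  · have hk' : k ∈ Set.Icc a b := by
      rw [Set.uIoc_of_le hab] at hk; exact Set.Ioc_subset_Icc_self hk
    have hexp : ‖-Complex.I * Complex.exp (Complex.I * (x * k - k ^ 2 * t))‖ = 1 := by
      rw [norm_mul, norm_neg, Complex.norm_I, one_mul, mul_comm Complex.I]
      exact_mod_cast Complex.norm_exp_ofReal_mul_I (x * k - k ^ (2 : ℕ) * t)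
    have hDk := hD k hk'
    have hDp : 0 < |x - 2 * k * t| := hd0.trans_le hDk
    have hC₁' : 0 ≤ C₁ := (abs_nonneg _).trans (hC₁ 0)
    have hC₀' : 0 ≤ C₀ := (abs_nonneg _).trans (hC₀ 0)
    rw [norm_mul, hexp, mul_one, Complex.norm_real, Real.norm_eq_abs]
    have h2t : |2 * t| ≤ |x - 2 * k * t| / a := by
      rw [le_div_iff₀ ha, abs_mul, abs_two]
      refine le_trans ?_ hDk
      rw [hd]
      nlinarith [abs_nonneg x]
    calc |u' k| ≤ (C₁ * |x - 2 * k * t| + C₀ * (|x - 2 * k * t| / a)) / |x - 2 * k * t| ^ 2 := by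
          rw [hu', abs_div, abs_pow]
          gcongr
          refine (abs_sub _ _).trans ?_
          rw [abs_mul, abs_mul, abs_neg]
          gcongr
          · exact hC₁ k
          · exact hC₀ k
      _ = (C₁ + C₀ / a) / |x - 2 * k * t| := by field_simp
      _ ≤ (C₁ + C₀ / a) / d := by gcongr
  · rw [abs_of_nonneg (sub_nonneg.2 hab)]
    ring

lemma exists_Ioo_of_tsupport_subset_Ioi {g : ℝ → ℝ} (hg : HasCompactSupport g)
    (hU : tsupport g ⊆ Set.Ioi 0) :
    ∃ a b : ℝ, 0 < a ∧ a ≤ b ∧ ∀ k, k ∉ Set.Ioo a b → g k = 0 := by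
  rcases (tsupport g).eq_empty_or_nonempty with h | h
  · exact ⟨1, 1, one_pos, le_rfl, fun k _ => image_eq_zero_of_notMem_tsupport (by simp [h])⟩
  · obtain ⟨m, hm, hm'⟩ := hg.isCompact.exists_isLeast h
    obtain ⟨M, hM, hM'⟩ := hg.isCompact.exists_isGreatest h
    have hm0 : 0 < m := hU hm
    have hmM : m ≤ M := hm' hM
    refine ⟨m / 2, M + 1, by positivity, by linarith, fun k hk => ?_⟩
    by_contra hne
    have hk' : k ∈ tsupport g := subset_tsupport g hne
    exact hk ⟨by linarith [hm' hk'], by linarith [hM' hk']⟩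

section Backflow

variable {S : ℝ → Hp →L[ℂ] Hp} {R : Hp →L[ℂ] HL} {Pm : HL →L[ℂ] HL}

lemma norm_R_S_apply_le (hSetup : Setup S R Pm) {g : ℝ → ℝ} (hg : ContDiff ℝ 1 g)
    (hgc : HasCompactSupport g) (hgU : tsupport g ⊆ Set.Ioi 0) {φ : Hp}
    (hφ : φ =ᵐ[μp] fun k => (g k : ℂ)) :
    ∃ C a : ℝ, 0 ≤ C ∧ 0 < a ∧ ∀ t : ℝ, t ≠ 0 → ∀ᵐ x : ℝ, x * t ≤ 0 →
      ‖R (S t φ) x‖ ≤ C / (|x| + 2 * a * |t|) := by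
  obtain ⟨a, b, ha, hab, hsupp⟩ := exists_Ioo_of_tsupport_subset_Ioi hgc hgU
  obtain ⟨C₀, hC₀⟩ := hgc.exists_bound_of_continuous hg.continuous
  obtain ⟨C₁, hC₁⟩ := hgc.deriv.exists_bound_of_continuous (hg.continuous_deriv le_rfl)
  have hC₁' : 0 ≤ C₁ := (norm_nonneg _).trans (hC₁ 0)
  have hC₀' : 0 ≤ C₀ := (norm_nonneg _).trans (hC₀ 0)
  set c : ℝ := (2 * Real.pi) ^ (-(1/2) : ℝ) with hc
  refine ⟨|c| * ((C₁ + C₀ / a) * (b - a)), a, ?_, ha, fun t ht => ?_⟩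
  · have := sub_nonneg.2 hab
    positivity
  have hSφ : (S t φ : ℝ → ℂ) =ᵐ[μp]
      fun k => Complex.exp (-Complex.I * (k:ℂ)^2 * (t:ℂ)) * g k := by
    filter_upwards [hSetup.hS t φ, hφ] with k h1 h2
    rw [h1, h2]
  have hint : Integrable (S t φ : ℝ → ℂ) μp := by
    refine Integrable.congr ?_ hSφ.symm
    refine (Continuous.integrable_of_hasCompactSupport (μ := volume) ?_ ?_).restrict
    · have := hg.continuous
      fun_prop
    · exact (hgc.comp_left (g := fun y : ℝ => (y : ℂ)) Complex.ofReal_zero).mul_left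
  filter_upwards [hSetup.hR _ hint] with x hx hxt
  have h1 : ∫ k in Set.Ioi (0:ℝ), Complex.exp (Complex.I * (x:ℂ) * (k:ℂ)) * S t φ k =
      ∫ k in a..b, (g k : ℂ) * Complex.exp (Complex.I * (x * k - k ^ 2 * t)) := by
    rw [intervalIntegral.integral_of_le hab]
    have h2 : ∫ k in Set.Ioi (0:ℝ), Complex.exp (Complex.I * (x:ℂ) * (k:ℂ)) * S t φ k =
        ∫ k in Set.Ioi (0:ℝ), (g k : ℂ) * Complex.exp (Complex.I * (x * k - k ^ 2 * t)) := by
      refine integral_congr_ae ?_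
      filter_upwards [hSφ] with k hk
      rw [hk, ← mul_assoc, ← Complex.exp_add, mul_comm]
      ring_nf
    rw [h2]
    refine (setIntegral_eq_of_subset_of_forall_sdiff_eq_zero measurableSet_Ioi
      (fun k hk => ha.trans hk.1) fun k hk => ?_)
    rw [hsupp k fun hk' => hk.2 (Set.Ioo_subset_Ioc_self hk')]
    simp
  rw [hx, h1, norm_mul, Complex.norm_real, Real.norm_eq_abs, mul_div_assoc]
  gcongr
  exact norm_integral_oscillatory_le hg ha hab (hsupp a (by simp)) (hsupp b (by simp)) hC₀ hC₁ ht hxt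

lemma memLp_one_add_abs_rpow :
    MemLp (fun x : ℝ => (1 + |x|) ^ (-(3 / 4) : ℝ)) 2 (volume : Measure ℝ) := by
  have hcont : Continuous fun x : ℝ => (1 + |x|) ^ (-(3 / 4) : ℝ) :=
    Continuous.rpow_const (by fun_prop) fun x => .inl (by positivity)
  rw [memLp_two_iff_integrable_sq hcont.aestronglyMeasurable]
  have h := integrable_one_add_norm (E := ℝ) (μ := volume) (r := 3 / 2) (by norm_num)
  refine h.congr (.of_forall fun x => ?_)
  simp only [Real.norm_eq_abs]
  rw [← Real.rpow_natCast, ← Real.rpow_mul (by positivity)]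
  norm_num

lemma inv_add_le_rpow_mul_rpow {y s : ℝ} (hy : 0 ≤ y) (hs : 1 ≤ s) :
    (y + s)⁻¹ ≤ s ^ (-(1 / 4) : ℝ) * (1 + y) ^ (-(3 / 4) : ℝ) := by
  have hs0 : 0 < s := one_pos.trans_le hs
  have h : (y + s)⁻¹ = (y + s) ^ (-(1 / 4) : ℝ) * (y + s) ^ (-(3 / 4) : ℝ) := by
    rw [← Real.rpow_add (by positivity), ← Real.rpow_neg_one]
    norm_num
  rw [h]
  gcongr ?_ * ?_
  · exact Real.rpow_le_rpow_of_nonpos hs0 (by linarith) (by norm_num)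
  · exact Real.rpow_le_rpow_of_nonpos (by positivity) (by linarith) (by norm_num)

lemma tendsto_zero_of_norm_le_div {l : Filter ℝ} (hl : Tendsto (fun t : ℝ => |t|) l atTop)
    {f : ℝ → HL} {C a : ℝ} (hC : 0 ≤ C) (ha : 0 < a)
    (h : ∀ᶠ t in l, ∀ᵐ x : ℝ, ‖f t x‖ ≤ C / (|x| + 2 * a * |t|)) :
    Tendsto f l (nhds 0) := by
  set w : Lp ℝ 2 (volume : Measure ℝ) := memLp_one_add_abs_rpow.toLp with hw
  have hs : Tendsto (fun t : ℝ => 2 * a * |t|) l atTop := hl.const_mul_atTop (by positivity)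
  refine squeeze_zero_norm' (a := fun t => C * (2 * a * |t|) ^ (-(1 / 4) : ℝ) * ‖w‖) ?_ ?_
  · filter_upwards [h, hs.eventually_ge_atTop 1] with t ht hst
    refine Lp.norm_le_mul_norm_of_ae_le_mul ?_
    filter_upwards [ht, memLp_one_add_abs_rpow.coeFn_toLp] with x hx hwx
    rw [hw, hwx, Real.norm_of_nonneg (by positivity), mul_assoc]
    refine hx.trans ?_
    rw [div_eq_mul_inv]
    gcongr
    exact inv_add_le_rpow_mul_rpow (abs_nonneg x) hst
  · have := (tendsto_rpow_neg_atTop (by norm_num : (0 : ℝ) < 1 / 4)).comp hs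
    simpa using (this.const_mul C).mul_const ‖w‖

lemma norm_S_apply (hSetup : Setup S R Pm) (t : ℝ) (φ : Hp) : ‖S t φ‖ = ‖φ‖ := by
  rw [Lp.norm_def, Lp.norm_def]
  congr 1
  refine eLpNorm_congr_norm_ae ?_
  filter_upwards [hSetup.hS t φ] with k hk
  have : -Complex.I * (k:ℂ)^2 * (t:ℂ) = ((-(k ^ 2 * t) : ℝ) : ℂ) * Complex.I := by
    push_cast; ring
  rw [hk, norm_mul, this, Complex.norm_exp_ofReal_mul_I, one_mul]

lemma norm_Pm_apply_le (hSetup : Setup S R Pm) (ψ : HL) : ‖Pm ψ‖ ≤ ‖ψ‖ := by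
  refine Lp.norm_le_norm_of_ae_le ?_
  filter_upwards [hSetup.hPm ψ] with x hx
  rw [hx]
  exact norm_indicator_le_norm_self _ _

lemma sub_Pm_apply (hSetup : Setup S R Pm) (ψ : HL) :
    (ψ - Pm ψ : HL) =ᵐ[volume] Set.indicator (Set.Ici (0:ℝ)) fun x => ψ x := by
  filter_upwards [hSetup.hPm ψ, Lp.coeFn_sub ψ (Pm ψ)] with x hx hsub
  rw [hsub, Pi.sub_apply, hx]
  by_cases h : x < 0
  · simp [h]
  · simp [h, not_lt.1 h]

lemma norm_sub_Pm_apply_le (hSetup : Setup S R Pm) (ψ : HL) : ‖ψ - Pm ψ‖ ≤ ‖ψ‖ := by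
  refine Lp.norm_le_norm_of_ae_le ?_
  filter_upwards [sub_Pm_apply hSetup ψ] with x hx
  rw [hx]
  exact norm_indicator_le_norm_self _ _

lemma inner_Pm_left (hSetup : Setup S R Pm) (ψ χ : HL) :
    inner ℂ (Pm ψ) χ = inner ℂ ψ (Pm χ) := by
  rw [L2.inner_def, L2.inner_def]
  refine integral_congr_ae ?_
  filter_upwards [hSetup.hPm ψ, hSetup.hPm χ] with x h1 h2
  rw [h1, h2]
  by_cases h : x < 0 <;> simp [h]

/-- The `C¹` functions compactly supported in `(0,∞)`, as elements of `L²((0,∞))`. -/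
def testFunctions : Set Hp :=
  {φ | ∃ g : ℝ → ℝ, ContDiff ℝ 1 g ∧ HasCompactSupport g ∧ tsupport g ⊆ Set.Ioi 0 ∧
    φ =ᵐ[μp] fun k => (g k : ℂ)}

lemma dense_span_testFunctions : Dense (Submodule.span ℂ testFunctions : Set Hp) := by
  rw [Submodule.dense_iff_topologicalClosure_eq_top, Submodule.topologicalClosure_eq_top_iff,
    Submodule.eq_bot_iff]
  intro f hf
  have hloc : LocallyIntegrableOn (f : ℝ → ℂ) (Set.Ioi 0) volume := by
    refine (locallyIntegrableOn_iff (isOpen_Ioi.isLocallyClosed)).2 fun K hK hKc => ?_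
    have h1 : MemLp (f : ℝ → ℂ) 2 (volume.restrict K) :=
      (Lp.memLp f).mono_measure (Measure.restrict_mono hK le_rfl)
    have : IsFiniteMeasure (volume.restrict K) := ⟨by simpa using hKc.measure_lt_top⟩
    exact h1.integrable (by norm_num)
  have h0 := isOpen_Ioi.ae_eq_zero_of_integral_contDiff_smul_eq_zero hloc fun g hg hgc hgU => ?_
  · rw [Lp.eq_zero_iff_ae_eq_zero]
    exact (ae_restrict_iff' measurableSet_Ioi).2 h0
  · have hmem : MemLp (fun k => (g k : ℂ)) 2 μp :=
      (Continuous.memLp_of_hasCompactSupport (μ := volume)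
        (Complex.continuous_ofReal.comp hg.continuous)
        (hgc.comp_left (g := fun y : ℝ => (y : ℂ)) Complex.ofReal_zero)).restrict _
    have h1 : inner ℂ hmem.toLp f = 0 :=
      (Submodule.mem_orthogonal _ _).1 hf _ (Submodule.subset_span
        ⟨g, hg.of_le (by exact_mod_cast le_top), hgc, hgU, hmem.coeFn_toLp⟩)
    rw [L2.inner_def] at h1
    rw [← setIntegral_eq_integral_of_forall_compl_eq_zero (s := Set.Ioi 0), ← h1]
    · refine integral_congr_ae ?_
      filter_upwards [hmem.coeFn_toLp] with k hk
      rw [hk]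
      simp [mul_comm]
    · intro k hk
      rw [image_eq_zero_of_notMem_tsupport fun h => hk (hgU h), zero_smul]

lemma tendsto_zero_of_dense_span {ι E F : Type*} [NormedAddCommGroup E] [NormedSpace ℂ E]
    [NormedAddCommGroup F] [NormedSpace ℂ F] {l : Filter ι} {T : ι → E →ₗ[ℂ] F}
    (hT : ∀ i x, ‖T i x‖ ≤ ‖x‖) {D : Set E} (hD : Dense (Submodule.span ℂ D : Set E))
    (h : ∀ x ∈ D, Tendsto (fun i => T i x) l (nhds 0)) (x : E) :
    Tendsto (fun i => T i x) l (nhds 0) := by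
  have hspan : ∀ y ∈ Submodule.span ℂ D, Tendsto (fun i => T i y) l (nhds 0) := fun y hy => by
    induction hy using Submodule.span_induction with
    | mem y hy => exact h y hy
    | zero => simpa using tendsto_const_nhds
    | add y z _ _ hy hz => simpa using hy.add hz
    | smul c y _ hy => simpa using hy.const_smul c
  rw [Metric.tendsto_nhds]
  intro ε hε
  obtain ⟨y, hy, hxy⟩ := hD.exists_dist_lt x (half_pos hε)
  filter_upwards [Metric.tendsto_nhds.1 (hspan y hy) (ε / 2) (half_pos hε)] with i hi
  rw [dist_zero_right] at hi ⊢
  calc ‖T i x‖ = ‖T i (x - y) + T i y‖ := by simp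
    _ ≤ ‖x - y‖ + ‖T i y‖ := (norm_add_le _ _).trans (by gcongr; exact hT i _)
    _ < ε := by rw [dist_eq_norm] at hxy; linarith

lemma tendsto_Pm_R_S_atTop (hSetup : Setup S R Pm) (φ : Hp) :
    Tendsto (fun t => Pm (R (S t φ))) atTop (nhds 0) := by
  refine tendsto_zero_of_dense_span (T := fun t => (Pm.comp (R.comp (S t))).toLinearMap)
    (fun t φ => ?_) dense_span_testFunctions (fun φ hφ => ?_) φ
  · refine (norm_Pm_apply_le hSetup _).trans ?_
    simp [hSetup.hR_isometry, norm_S_apply hSetup]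
  · obtain ⟨g, hg, hgc, hgU, hφ⟩ := hφ
    obtain ⟨C, a, hC, ha, h⟩ := norm_R_S_apply_le hSetup hg hgc hgU hφ
    refine tendsto_zero_of_norm_le_div tendsto_abs_atTop_atTop hC ha ?_
    filter_upwards [eventually_gt_atTop 0] with t ht
    filter_upwards [h t ht.ne', hSetup.hPm (R (S t φ))] with x hx hPx
    change ‖Pm (R (S t φ)) x‖ ≤ _
    rw [hPx]
    by_cases hx0 : x < 0
    · simpa [hx0] using hx (mul_nonpos_of_nonpos_of_nonneg hx0.le ht.le)
    · simp only [Set.mem_Iio, hx0, not_false_eq_true, Set.indicator_of_notMem, norm_zero]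
      positivity

lemma tendsto_sub_Pm_R_S_atBot (hSetup : Setup S R Pm) (φ : Hp) :
    Tendsto (fun t => R (S t φ) - Pm (R (S t φ))) atBot (nhds 0) := by
  refine tendsto_zero_of_dense_span
    (T := fun t => (R.comp (S t) - Pm.comp (R.comp (S t))).toLinearMap)
    (fun t φ => ?_) dense_span_testFunctions (fun φ hφ => ?_) φ
  · refine (norm_sub_Pm_apply_le hSetup _).trans ?_
    simp [hSetup.hR_isometry, norm_S_apply hSetup]
  · obtain ⟨g, hg, hgc, hgU, hφ⟩ := hφ
    obtain ⟨C, a, hC, ha, h⟩ := norm_R_S_apply_le hSetup hg hgc hgU hφ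
    refine tendsto_zero_of_norm_le_div tendsto_abs_atBot_atTop hC ha ?_
    filter_upwards [eventually_lt_atBot 0] with t ht
    filter_upwards [h t ht.ne, sub_Pm_apply hSetup (R (S t φ))] with x hx hPx
    change ‖(R (S t φ) - Pm (R (S t φ)) : HL) x‖ ≤ _
    rw [hPx]
    by_cases hx0 : 0 ≤ x
    · simpa [hx0] using hx (mul_nonpos_of_nonneg_of_nonpos hx0 ht.le)
    · simp only [Set.mem_Ici, hx0, not_false_eq_true, Set.indicator_of_notMem, norm_zero]
      positivity

/-- The Heisenberg-picture probability operator `S_t* R* Π⁻ R S_t`. -/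
def leftProb (S : ℝ → Hp →L[ℂ] Hp) (R : Hp →L[ℂ] HL) (Pm : HL →L[ℂ] HL) (t : ℝ) : Hp →L[ℂ] Hp :=
  (ContinuousLinearMap.adjoint (S t)).comp ((ContinuousLinearMap.adjoint R).comp
    (Pm.comp (R.comp (S t))))

lemma norm_adjoint_S_adjoint_R_le (hSetup : Setup S R Pm) (t : ℝ) (ψ : HL) :
    ‖ContinuousLinearMap.adjoint (S t) (ContinuousLinearMap.adjoint R ψ)‖ ≤ ‖ψ‖ := by
  have h1 : ‖ContinuousLinearMap.adjoint (S t)‖ ≤ 1 := by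
    rw [LinearIsometryEquiv.norm_map]
    exact ContinuousLinearMap.opNorm_le_bound _ zero_le_one
      fun x => by rw [norm_S_apply hSetup, one_mul]
  have h2 : ‖ContinuousLinearMap.adjoint R‖ ≤ 1 := by
    rw [LinearIsometryEquiv.norm_map]
    exact ContinuousLinearMap.opNorm_le_bound _ zero_le_one
      fun x => by rw [hSetup.hR_isometry, one_mul]
  calc _ ≤ 1 * (1 * ‖ψ‖) :=
        ContinuousLinearMap.le_of_opNorm_le_of_le _ h1 (ContinuousLinearMap.le_of_opNorm_le _ h2 _)
    _ = ‖ψ‖ := by ring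

lemma norm_leftProb_le (hSetup : Setup S R Pm) (t : ℝ) : ‖leftProb S R Pm t‖ ≤ 1 := by
  refine ContinuousLinearMap.opNorm_le_bound _ zero_le_one fun φ => ?_
  refine (norm_adjoint_S_adjoint_R_le hSetup t _).trans ((norm_Pm_apply_le hSetup _).trans ?_)
  simp [hSetup.hR_isometry, norm_S_apply hSetup]

lemma isSelfAdjoint_leftProb (hSetup : Setup S R Pm) (t : ℝ) :
    IsSelfAdjoint (leftProb S R Pm t) := by
  rw [ContinuousLinearMap.isSelfAdjoint_iff_isSymmetric]
  intro x y
  simp [leftProb, ContinuousLinearMap.adjoint_inner_left, ContinuousLinearMap.adjoint_inner_right,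
    inner_Pm_left hSetup]

lemma tendsto_leftProb_atTop (hSetup : Setup S R Pm) (φ : Hp) :
    Tendsto (fun t => leftProb S R Pm t φ) atTop (nhds 0) :=
  squeeze_zero_norm (fun t => norm_adjoint_S_adjoint_R_le hSetup t _)
    (by simpa using (tendsto_Pm_R_S_atTop hSetup φ).norm)

lemma tendsto_leftProb_atBot (hSetup : Setup S R Pm) (φ : Hp) :
    Tendsto (fun t => leftProb S R Pm t φ) atBot (nhds φ) := by
  have h : ∀ t, leftProb S R Pm t φ = φ - ContinuousLinearMap.adjoint (S t)
      (ContinuousLinearMap.adjoint R (R (S t φ) - Pm (R (S t φ)))) := fun t => by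
    have hS := (ContinuousLinearMap.norm_map_iff_adjoint_comp_self (S t)).1 (norm_S_apply hSetup t)
    have hR := (ContinuousLinearMap.norm_map_iff_adjoint_comp_self R).1 hSetup.hR_isometry
    have hS' := DFunLike.congr_fun hS φ
    have hR' := DFunLike.congr_fun hR (S t φ)
    simp only [ContinuousLinearMap.comp_apply, one_apply_eq_self] at hS' hR'
    simp [leftProb, hS', hR']
  simp only [h]
  have h0 : Tendsto (fun t => ContinuousLinearMap.adjoint (S t)
      (ContinuousLinearMap.adjoint R (R (S t φ) - Pm (R (S t φ))))) atBot (nhds 0) :=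
    squeeze_zero_norm (fun t => norm_adjoint_S_adjoint_R_le hSetup t _)
      (by simpa using (tendsto_sub_Pm_R_S_atBot hSetup φ).norm)
  simpa using h0.const_sub φ

instance : Nontrivial Hp := by
  have hμ : μp (Set.Ioc 0 1) = 1 := by
    rw [Measure.restrict_apply measurableSet_Ioc,
      Set.inter_eq_left.2 fun x hx => hx.1, Real.volume_Ioc]
    simp
  refine nontrivial_of_ne
    (indicatorConstLp 2 (μ := μp) (measurableSet_Ioc (a := (0:ℝ)) (b := 1)) (by simp [hμ]) (1 : ℂ)) 0
    fun h => ?_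
  have := congrArg norm h
  rw [norm_indicatorConstLp (by norm_num) (by norm_num)] at this
  simp [Measure.real, hμ] at this

lemma sum_fin_pair {V : Type*} [AddCommGroup V] (N : ℕ) (f : ℕ → V) :
    ∑ j : Fin N, (f (2 * j + 1) - f (2 * j)) =
      ∑ i ∈ Finset.range (2 * N), (-1 : ℤ) ^ (i + 1) • f i := by
  rw [Fin.sum_univ_eq_sum_range (fun j => f (2 * j + 1) - f (2 * j)) N]
  induction N with
  | zero => simp
  | succ N ih =>
    have h : (-1 : ℤ) ^ (2 * N) = 1 := (even_two_mul N).neg_one_pow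
    rw [Finset.sum_range_succ, ih, mul_add, mul_one, Finset.sum_range_succ, Finset.sum_range_succ]
    simp only [pow_succ, h, one_mul, neg_mul, neg_neg, one_smul, neg_smul]
    abel

lemma isSelfAdjoint_BM (hSetup : Setup S R Pm) (M : ℕ) (t : Fin (2 * M) → ℝ) :
    IsSelfAdjoint (BM S R Pm M t) :=
  isSelfAdjoint_sum _ fun _ _ =>
    (isSelfAdjoint_leftProb hSetup _).sub (isSelfAdjoint_leftProb hSetup _)

lemma norm_BM_le (hSetup : Setup S R Pm) (M : ℕ) (t : Fin (2 * M) → ℝ) :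
    ‖BM S R Pm M t‖ ≤ M * 2 := by
  have hsum : (M * 2 : ℝ) = ∑ _j : Fin M, (2 : ℝ) := by simp
  rw [hsum]
  refine norm_sum_le_of_le _ fun j _ => ?_
  refine (norm_sub_le _ _).trans ?_
  exact (add_le_add (norm_leftProb_le hSetup _) (norm_leftProb_le hSetup _)).trans_eq (by norm_num)

lemma BM_apply_eq_sum (M : ℕ) (t : Fin (2 * M) → ℝ) (φ : Hp) :
    BM S R Pm M t φ = ∑ i ∈ Finset.range (2 * M), (-1 : ℤ) ^ (i + 1) •
      (if h : i < 2 * M then leftProb S R Pm (t ⟨i, h⟩) φ else 0) := by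
  rw [← sum_fin_pair M fun i => if h : i < 2 * M then leftProb S R Pm (t ⟨i, h⟩) φ else 0]
  simp only [BM, _root_.sum_apply]
  refine Finset.sum_congr rfl fun j _ => ?_
  have := j.isLt
  rw [dif_pos (by omega), dif_pos (by omega)]
  rfl

lemma sum_range_neg_one_pow_smul {V : Type*} [AddCommGroup V] {j : ℕ} (hj : Odd j) (v : V) :
    ∑ i ∈ Finset.range j, (-1 : ℤ) ^ (i + 1) • v = -v := by
  rw [← Finset.sum_smul]
  have : ∑ i ∈ Finset.range j, (-1 : ℤ) ^ (i + 1) = -1 := by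
    simp_rw [pow_succ, ← Finset.sum_mul, neg_one_geom_sum, if_neg (Nat.not_even_iff_odd.2 hj),
      one_mul]
  rw [this, neg_one_smul]

lemma tendsto_BM_concat3 (hSetup : Setup S R Pm) {M L j k : ℕ} (hj : Odd j)
    (hjk : j + k = 2 * L) (t : Fin (2 * M) → ℝ) {r : ℕ → Fin j → ℝ} {s : ℕ → Fin k → ℝ}
    (hr : ∀ i, Tendsto (fun n => r n i) atTop atBot)
    (hs : ∀ i, Tendsto (fun n => s n i) atTop atTop) (φ : Hp) :
    Tendsto (fun n => BM S R Pm (M + L) (concat3 hjk (r n) t (s n)) φ) atTop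
      (nhds (-φ - BM S R Pm M t φ)) := by
  simp only [BM_apply_eq_sum (M + L)]
  have hlim : ∀ i ∈ Finset.range (2 * (M + L)), Tendsto (fun n => (-1 : ℤ) ^ (i + 1) •
      (if h : i < 2 * (M + L) then
        leftProb S R Pm (concat3 hjk (r n) t (s n) ⟨i, h⟩) φ else 0)) atTop
      (nhds ((-1 : ℤ) ^ (i + 1) • (if i < j then φ else if h : i - j < 2 * M then
        leftProb S R Pm (t ⟨i - j, h⟩) φ else 0))) := fun i hi => by
    have hi' := Finset.mem_range.1 hi
    refine Tendsto.const_smul ?_ _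
    simp only [hi', dif_pos]
    by_cases h1 : i < j
    · simp only [concat3, h1, dif_pos, if_pos]
      exact (tendsto_leftProb_atBot hSetup φ).comp (hr _)
    by_cases h2 : i < j + 2 * M
    · have h3 : i - j < 2 * M := by omega
      simp only [concat3, h1, h2, h3, dif_pos, dif_neg, if_neg, not_false_eq_true]
      exact tendsto_const_nhds
    · have h3 : ¬ i - j < 2 * M := by omega
      simp only [concat3, h1, h2, h3, dif_neg, if_neg, not_false_eq_true]
      exact (tendsto_leftProb_atTop hSetup φ).comp (hs _)
  convert tendsto_finsetSum _ hlim using 2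
  rw [show 2 * (M + L) = j + (2 * M + k) by omega, Finset.sum_range_add, Finset.sum_range_add,
    BM_apply_eq_sum, sub_eq_add_neg, ← sum_range_neg_one_pow_smul hj φ, ← Finset.sum_neg_distrib]
  have hzero : ∑ i ∈ Finset.range k, (-1 : ℤ) ^ (j + (2 * M + i) + 1) •
      (if j + (2 * M + i) < j then φ else if h : j + (2 * M + i) - j < 2 * M then
        leftProb S R Pm (t ⟨j + (2 * M + i) - j, h⟩) φ else 0) = 0 := by
    refine Finset.sum_eq_zero fun i _ => ?_
    rw [if_neg (by omega), dif_neg (by omega), smul_zero]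
  rw [hzero, add_zero]
  congr 1
  · refine Finset.sum_congr rfl fun i hi => ?_
    rw [if_pos (Finset.mem_range.1 hi)]
  · refine Finset.sum_congr rfl fun i hi => ?_
    have hi' := Finset.mem_range.1 hi
    rw [if_neg (by omega), add_assoc, pow_add _ j, hj.neg_one_pow, neg_one_mul, neg_smul]
    simp only [hi', dif_pos, add_tsub_cancel_left]

end Backflow

/-- padding with `j` extra times going to `−∞` and `k` extra times going to `+∞`
(`j, k` odd, `j + k = 2L`), one has
`liminf sSup σ(B^{(M+L)}) ≥ −1 − sInf σ(B^{(M)}_t)` and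
`limsup sInf σ(B^{(M+L)}) ≤ −1 − sSup σ(B^{(M)}_t)`. -/
theorem backflow_padding_odd
    (S : ℝ → Hp →L[ℂ] Hp) (R : Hp →L[ℂ] HL) (Pm : HL →L[ℂ] HL)
    (hSetup : Setup S R Pm)
    (M L j k : ℕ) (hM : 1 ≤ M) (hL : 1 ≤ L)
    (hj : Odd j) (hk : Odd k) (hjk : j + k = 2*L)
    (t : Fin (2*M) → ℝ) (ht : StrictMono t)
    (r : ℕ → Fin j → ℝ) (s : ℕ → Fin k → ℝ)
    (hmono : ∀ n : ℕ, StrictMono (concat3 hjk (r n) t (s n)))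
    (hrlim : Tendsto (fun n : ℕ =>
        r n ⟨j - 1, by obtain ⟨m, hm⟩ := hj; omega⟩) atTop atBot)
    (hslim : Tendsto (fun n : ℕ =>
        s n ⟨0, by obtain ⟨m, hm⟩ := hk; omega⟩) atTop atTop) :
    -1 - sInf (spectrum ℝ (BM S R Pm M t)) ≤
      liminf (fun n : ℕ =>
        sSup (spectrum ℝ (BM S R Pm (M+L) (concat3 hjk (r n) t (s n))))) atTop ∧
    limsup (fun n : ℕ =>
        sInf (spectrum ℝ (BM S R Pm (M+L) (concat3 hjk (r n) t (s n))))) atTop ≤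
      -1 - sSup (spectrum ℝ (BM S R Pm M t)) := by
  have : 0 < j := hj.pos
  have : 0 < k := hk.pos
  have hr : ∀ i, Tendsto (fun n => r n i) atTop atBot := fun i => by
    refine tendsto_atBot_mono (fun n => ?_) hrlim
    have := i.isLt
    have h := (hmono n).monotone (a := ⟨i, by omega⟩) (b := ⟨j - 1, by omega⟩)
      (Fin.mk_le_mk.2 (by omega))
    simpa [concat3, hj.pos] using h
  have hs : ∀ i, Tendsto (fun n => s n i) atTop atTop := fun i => by
    refine tendsto_atTop_mono (fun n => ?_) hslim
    have := i.isLt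
    have h := (hmono n).monotone (a := ⟨j + 2 * M, by omega⟩) (b := ⟨j + 2 * M + i, by omega⟩)
      (Fin.mk_le_mk.2 (by omega))
    have h1 : ¬ j + 2 * M < j := by omega
    have h2 : ¬ j + 2 * M + (i : ℕ) < j := by omega
    simpa [concat3, h1, h2] using h
  exact liminf_limsup_spectrum_of_tendsto_neg_one_sub (fun n => isSelfAdjoint_BM hSetup _ _)
    (isSelfAdjoint_BM hSetup _ _) (fun n => norm_BM_le hSetup _ _)
    (tendsto_BM_concat3 hSetup hj hjk t hr hs)

end QB
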